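/- Define k(ρ,θ,τ) = exp(−τF₁(ρ,θ))·(1 + F₂(ρ,θ)/F₁(ρ,θ)) − F₂(ρ,θ)/F₁(ρ,θ) when F₁(ρ,θ) ≠ 0 and k(ρ,θ,τ) = 1 − τF₂(ρ,θ) when F₁(ρ,θ) = 0, and set q(s,θ,τ) = M + ∫_M^s k(ρ,θ,τ) dρ, W(s,θ) = ∂_σF₀(s,θ), V̂(s,θ,τ) = ∫_M^s ∂_σF₀(ρ,θ) k(ρ,θ,τ) dρ. Then for all s ≤ M, θ ∈ [0,2π] and τ ≥ 0 the triple (q, V̂, W) solves the ε = 0 blowup system (3.9): ∂_τ q(s,θ,τ) + Σ_{i,j=0}^2 (d_ij V̂(s,θ,τ) + Σ_{k=0}^2 e_ij^k ω̂_k W(s,θ)) ω̂_i ω̂_j = 0, ∂_τ W = 0, and ∂_s V̂(s,θ,τ) = W(s,θ) ∂_s q(s,θ,τ), with q(s,θ,0) = s, V̂(s,θ,0) = F₀(s,θ), q(M,θ,τ) = M, W(M,θ) = 0. -/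

import Mathlib

open Real MeasureTheory Filter Topology Asymptotics

noncomputable section

/-- Partial derivative in the `i`-th coordinate direction on `Fin 3 → ℝ`
(coordinates `y = (t, x₁, x₂)`). -/
def pd (i : Fin 3) (f : (Fin 3 → ℝ) → ℝ) : (Fin 3 → ℝ) → ℝ :=
  fun y => fderiv ℝ f y (Pi.single i 1)

/-- Radon transform of `v : ℝ² → ℝ` over the line `x · ω = s`, where
`ω = (cos θ, sin θ)`. -/
def radon (v : ℝ × ℝ → ℝ) (s θ : ℝ) : ℝ :=
  ∫ t : ℝ, v (s * Real.cos θ - t * Real.sin θ, s * Real.sin θ + t * Real.cos θ)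

/-- `ω̂ = (-1, cos θ, sin θ)`. -/
def omegaHat (θ : ℝ) : Fin 3 → ℝ := ![(-1 : ℝ), Real.cos θ, Real.sin θ]

/-- The Friedlander radiation field `F₀` associated with the data `(φ₀, φ₁)`. -/
def F0 (φ0 φ1 : ℝ × ℝ → ℝ) (σ θ : ℝ) : ℝ :=
  (1 / (2 * Real.pi * Real.sqrt 2)) *
    ∫ s in Set.Ioi σ,
      (radon φ1 s θ - deriv (fun s' => radon φ0 s' θ) s) / Real.sqrt (s - σ)

/-- `F₁(σ,θ) = (Σ d_ij ω̂_i ω̂_j) ∂_σ F₀(σ,θ)`. -/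
def F1 (d : Fin 3 → Fin 3 → ℝ) (φ0 φ1 : ℝ × ℝ → ℝ) (σ θ : ℝ) : ℝ :=
  (∑ i : Fin 3, ∑ j : Fin 3, d i j * omegaHat θ i * omegaHat θ j) *
    deriv (fun σ' => F0 φ0 φ1 σ' θ) σ

/-- `F₂(σ,θ) = (Σ e_ij^k ω̂_i ω̂_j ω̂_k) ∂²_σ F₀(σ,θ)`. -/
def F2 (e : Fin 3 → Fin 3 → Fin 3 → ℝ) (φ0 φ1 : ℝ × ℝ → ℝ) (σ θ : ℝ) : ℝ :=
  (∑ i : Fin 3, ∑ j : Fin 3, ∑ k : Fin 3,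
      e i j k * omegaHat θ i * omegaHat θ j * omegaHat θ k) *
    deriv (fun σ' => deriv (fun σ'' => F0 φ0 φ1 σ'' θ) σ') σ

/-- `G₀(σ,θ) = (1/F₁) log(1 + F₁/F₂)`. -/
def G0 (d : Fin 3 → Fin 3 → ℝ) (e : Fin 3 → Fin 3 → Fin 3 → ℝ)
    (φ0 φ1 : ℝ × ℝ → ℝ) (σ θ : ℝ) : ℝ :=
  (1 / F1 d φ0 φ1 σ θ) * Real.log (1 + F1 d φ0 φ1 σ θ / F2 e φ0 φ1 σ θ)

/-- The set `A`. -/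
def setA (M : ℝ) (d : Fin 3 → Fin 3 → ℝ) (e : Fin 3 → Fin 3 → Fin 3 → ℝ)
    (φ0 φ1 : ℝ × ℝ → ℝ) : Set (ℝ × ℝ) :=
  {p | p.1 < M ∧ p.2 ∈ Set.Icc 0 (2 * Real.pi) ∧
    F1 d φ0 φ1 p.1 p.2 ≠ 0 ∧ F2 e φ0 φ1 p.1 p.2 ≠ 0 ∧
    0 < 1 + F1 d φ0 φ1 p.1 p.2 / F2 e φ0 φ1 p.1 p.2}

/-- The set `B = {(σ,θ) ∈ A : G₀(σ,θ) > 0}`. -/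
def setB (M : ℝ) (d : Fin 3 → Fin 3 → ℝ) (e : Fin 3 → Fin 3 → Fin 3 → ℝ)
    (φ0 φ1 : ℝ × ℝ → ℝ) : Set (ℝ × ℝ) :=
  {p ∈ setA M d e φ0 φ1 | 0 < G0 d e φ0 φ1 p.1 p.2}

/-- `τ₀ = inf_{(σ,θ) ∈ B} G₀(σ,θ)`. -/
def tau0 (M : ℝ) (d : Fin 3 → Fin 3 → ℝ) (e : Fin 3 → Fin 3 → Fin 3 → ℝ)
    (φ0 φ1 : ℝ × ℝ → ℝ) : ℝ :=
  sInf ((fun p : ℝ × ℝ => G0 d e φ0 φ1 p.1 p.2) '' setB M d e φ0 φ1)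

/-- The set `D = {(σ,θ) : σ < M, F₁ = 0, F₂ > 0}`. -/
def setD (M : ℝ) (d : Fin 3 → Fin 3 → ℝ) (e : Fin 3 → Fin 3 → Fin 3 → ℝ)
    (φ0 φ1 : ℝ × ℝ → ℝ) : Set (ℝ × ℝ) :=
  {p | p.1 < M ∧ p.2 ∈ Set.Icc 0 (2 * Real.pi) ∧
    F1 d φ0 φ1 p.1 p.2 = 0 ∧ 0 < F2 e φ0 φ1 p.1 p.2}

/-- `φ` is supported in the closed disk of radius `M` centered at the origin. -/
def SuppIn (M : ℝ) (φ : ℝ × ℝ → ℝ) : Prop :=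
  ∀ x : ℝ × ℝ, M ^ 2 < x.1 ^ 2 + x.2 ^ 2 → φ x = 0

/-- The cubic form `Σ e_ij^k ξ_i ξ_j ξ_k` does not satisfy the null condition:
it does not vanish identically on the light cone. -/
def NullCondFails (e : Fin 3 → Fin 3 → Fin 3 → ℝ) : Prop :=
  ∃ ξ : Fin 3 → ℝ, ξ 0 ^ 2 = ξ 1 ^ 2 + ξ 2 ^ 2 ∧ (ξ 1 ≠ 0 ∨ ξ 2 ≠ 0) ∧
    (∑ i : Fin 3, ∑ j : Fin 3, ∑ k : Fin 3, e i j k * ξ i * ξ j * ξ k) ≠ 0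

/-- Hessian (as a 2×2 matrix) of a function of two real variables. -/
def hessCurried (f : ℝ → ℝ → ℝ) (σ θ : ℝ) : Matrix (Fin 2) (Fin 2) ℝ :=
  !![deriv (fun a => deriv (fun b => f b θ) a) σ,
     deriv (fun a => deriv (fun b => f a b) θ) σ;
     deriv (fun b => deriv (fun a => f a b) σ) θ,
     deriv (fun b => deriv (fun b' => f σ b') b) θ]

/-- Minkowski coefficients: `Σ c_ij ∂_ij = ∂_t² - Δ`. -/
def cMink : Fin 3 → Fin 3 → ℝ := fun i j =>
  if i = j then (if i = 0 then 1 else -1) else 0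

/-- `u` is a `C^∞` solution of problem (1.1) on `[0,T) × ℝ²`. -/
def IsSol (g : Fin 3 → Fin 3 → ℝ → (Fin 3 → ℝ) → ℝ) (ε : ℝ)
    (φ0 φ1 : ℝ × ℝ → ℝ) (u : (Fin 3 → ℝ) → ℝ) (T : ℝ) : Prop :=
  ContDiffOn ℝ (⊤ : ℕ∞) u {y | 0 ≤ y 0 ∧ y 0 < T} ∧
  (∀ y : Fin 3 → ℝ, 0 ≤ y 0 → y 0 < T →
    ∑ i : Fin 3, ∑ j : Fin 3,
      g i j (u y) (fun k => pd k u y) * pd i (pd j u) y = 0) ∧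
  (∀ x : ℝ × ℝ, u ![0, x.1, x.2] = ε * φ0 x ∧ pd 0 u ![0, x.1, x.2] = ε * φ1 x)

/-- The lifespan `T_ε`: the supremum of times of existence of smooth solutions. -/
def lifespan (g : Fin 3 → Fin 3 → ℝ → (Fin 3 → ℝ) → ℝ) (ε : ℝ)
    (φ0 φ1 : ℝ × ℝ → ℝ) : ℝ :=
  sSup {T : ℝ | ∃ u, IsSol g ε φ0 φ1 u T}

/-- `V` is a `C^∞` solution of the profile problem (2.1) on `ℝ × S¹ × [0, τmax)`. -/
def IsProfileSol (M : ℝ) (d : Fin 3 → Fin 3 → ℝ) (e : Fin 3 → Fin 3 → Fin 3 → ℝ)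
    (φ0 φ1 : ℝ × ℝ → ℝ) (τmax : ℝ) (V : ℝ → ℝ → ℝ → ℝ) : Prop :=
  ContDiffOn ℝ (⊤ : ℕ∞) (fun p : ℝ × ℝ × ℝ => V p.1 p.2.1 p.2.2)
    {p : ℝ × ℝ × ℝ | 0 ≤ p.2.2 ∧ p.2.2 < τmax} ∧
  (∀ q θ τ : ℝ, V q (θ + 2 * Real.pi) τ = V q θ τ) ∧
  (∀ q θ τ : ℝ, M < q → V q θ τ = 0) ∧
  (∀ q θ : ℝ, V q θ 0 = F0 φ0 φ1 q θ) ∧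
  (∀ q θ τ : ℝ, 0 ≤ τ → τ < τmax →
    deriv (fun τ' => deriv (fun q' => V q' θ τ') q) τ -
      ∑ i : Fin 3, ∑ j : Fin 3,
        (d i j * V q θ τ +
          ∑ k : Fin 3, e i j k * omegaHat θ k * deriv (fun q' => V q' θ τ) q) *
        omegaHat θ i * omegaHat θ j *
        deriv (fun q' => deriv (fun q'' => V q'' θ τ) q') q = 0)

/-- The Jacobian `∂_s q` of the characteristic flow. -/
def kfun (d : Fin 3 → Fin 3 → ℝ) (e : Fin 3 → Fin 3 → Fin 3 → ℝ)
    (φ0 φ1 : ℝ × ℝ → ℝ) (ρ θ τ : ℝ) : ℝ :=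
  if F1 d φ0 φ1 ρ θ = 0 then 1 - τ * F2 e φ0 φ1 ρ θ
  else Real.exp (-τ * F1 d φ0 φ1 ρ θ) * (1 + F2 e φ0 φ1 ρ θ / F1 d φ0 φ1 ρ θ)
        - F2 e φ0 φ1 ρ θ / F1 d φ0 φ1 ρ θ

/-- Partial derivatives on `ℝ × ℝ × ℝ` (coordinates `(s, θ, τ)`). -/
def pd3 : Fin 3 → (ℝ × ℝ × ℝ → ℝ) → ℝ × ℝ × ℝ → ℝ :=
  ![fun f p => deriv (fun a => f (a, p.2.1, p.2.2)) p.1,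
    fun f p => deriv (fun a => f (p.1, a, p.2.2)) p.2.1,
    fun f p => deriv (fun a => f (p.1, p.2.1, a)) p.2.2]

/-- Hessian in the first two variables `(s, θ)` of a function on `ℝ × ℝ × ℝ`. -/
def hessST (f : ℝ × ℝ × ℝ → ℝ) (p : ℝ × ℝ × ℝ) : Matrix (Fin 2) (Fin 2) ℝ :=
  !![pd3 0 (pd3 0 f) p, pd3 0 (pd3 1 f) p;
     pd3 1 (pd3 0 f) p, pd3 1 (pd3 1 f) p]

/-- The Klainerman vector fields on `ℝ_t × ℝ²`:
`∂_t, ∂_1, ∂_2, S = t∂_t + x₁∂_1 + x₂∂_2, H₁, H₂, R`. -/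
def KOp : Fin 7 → ((Fin 3 → ℝ) → ℝ) → (Fin 3 → ℝ) → ℝ :=
  ![fun f => pd 0 f,
    fun f => pd 1 f,
    fun f => pd 2 f,
    fun f y => y 0 * pd 0 f y + y 1 * pd 1 f y + y 2 * pd 2 f y,
    fun f y => y 1 * pd 0 f y + y 0 * pd 1 f y,
    fun f y => y 2 * pd 0 f y + y 0 * pd 2 f y,
    fun f y => y 1 * pd 2 f y - y 2 * pd 1 f y]

/-- `Z^α`: iterated product of Klainerman vector fields indexed by a list. -/
def Zpow (α : List (Fin 7)) (f : (Fin 3 → ℝ) → ℝ) : (Fin 3 → ℝ) → ℝ :=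
  α.foldr (fun i acc => KOp i acc) f

end

noncomputable section

/-- The characteristic flow `q(s,θ,τ) = M + ∫_M^s k(ρ,θ,τ) dρ`. -/
def qflow (M : ℝ) (d : Fin 3 → Fin 3 → ℝ) (e : Fin 3 → Fin 3 → Fin 3 → ℝ)
    (φ0 φ1 : ℝ × ℝ → ℝ) (s θ τ : ℝ) : ℝ :=
  M + ∫ ρ in M..s, kfun d e φ0 φ1 ρ θ τ

/-- `W(s,θ) = ∂_σ F₀(s,θ)`. -/
def Wfun (φ0 φ1 : ℝ × ℝ → ℝ) (s θ : ℝ) : ℝ :=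
  deriv (fun σ => F0 φ0 φ1 σ θ) s

/-- `V̂(s,θ,τ) = ∫_M^s ∂_σ F₀(ρ,θ) k(ρ,θ,τ) dρ`. -/
def Vhat (M : ℝ) (d : Fin 3 → Fin 3 → ℝ) (e : Fin 3 → Fin 3 → Fin 3 → ℝ)
    (φ0 φ1 : ℝ × ℝ → ℝ) (s θ τ : ℝ) : ℝ :=
  ∫ ρ in M..s, Wfun φ0 φ1 ρ θ * kfun d e φ0 φ1 ρ θ τ

end


lemma aux_zero {M : ℝ} (hM : 0 < M) {φ : ℝ × ℝ → ℝ} (hs : SuppIn M φ) (s t θ : ℝ)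
    (h : M ^ 2 < s ^ 2 + t ^ 2) :
    φ (s * Real.cos θ - t * Real.sin θ, s * Real.sin θ + t * Real.cos θ) = 0 := by
  apply hs
  have := Real.sin_sq_add_cos_sq θ
  have h2 : (s * Real.cos θ - t * Real.sin θ) ^ 2 + (s * Real.sin θ + t * Real.cos θ) ^ 2
      = (s ^ 2 + t ^ 2) * (Real.sin θ ^ 2 + Real.cos θ ^ 2) := by ring
  simp only [h2, this, mul_one, h]

lemma radon_zero {M : ℝ} (hM : 0 < M) {φ : ℝ × ℝ → ℝ} (hs : SuppIn M φ) (s θ : ℝ)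
    (h : M < |s|) : radon φ s θ = 0 := by
  unfold radon
  have : ∀ t : ℝ, φ (s * Real.cos θ - t * Real.sin θ, s * Real.sin θ + t * Real.cos θ) = 0 := by
    intro t
    apply aux_zero hM hs
    have : M ^ 2 < s ^ 2 := by rw [← sq_abs s]; gcongr
    nlinarith [sq_nonneg t]
  simp [this]

lemma radon_smooth {M : ℝ} (hM : 0 < M) {φ : ℝ × ℝ → ℝ} (hs : SuppIn M φ)
    (hφ : ContDiff ℝ (⊤ : ℕ∞) φ) (θ : ℝ) :
    ContDiff ℝ (⊤ : ℕ∞) (fun s => radon φ s θ) := by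
  have key := contDiffOn_convolution_right_with_param_comp (n := (⊤ : ℕ∞))
    (μ := (volume : Measure ℝ)) (𝕜 := ℝ) (f := fun _ : ℝ => (1 : ℝ))
    (ContinuousLinearMap.lsmul ℝ ℝ : ℝ →L[ℝ] ℝ →L[ℝ] ℝ)
    (g := fun s t : ℝ => φ (s * Real.cos θ - (-t) * Real.sin θ,
      s * Real.sin θ + (-t) * Real.cos θ)) (s := Set.univ) (k := Set.Icc (-M) M)
    (v := fun _ => 0) contDiffOn_const isOpen_univ isCompact_Icc
    (by
      intro s t _ ht
      apply aux_zero hM hs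
      have : M < |t| := by
        by_contra hc
        exact ht (abs_le.1 (not_lt.1 hc))
      have : M ^ 2 < t ^ 2 := by rw [← sq_abs t]; gcongr
      nlinarith [sq_nonneg s])
    (locallyIntegrable_const _)
    (by
      apply ContDiff.contDiffOn
      apply hφ.comp
      change ContDiff ℝ (⊤ : ℕ∞) (fun p : ℝ × ℝ => (p.1 * Real.cos θ - (-p.2) * Real.sin θ,
        p.1 * Real.sin θ + (-p.2) * Real.cos θ))
      fun_prop)
  rw [contDiffOn_univ] at key
  convert key using 2 with s
  simp [radon, convolution]

lemma kernel_li : LocallyIntegrable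
    (fun t : ℝ => Set.indicator (Set.Iio (0 : ℝ)) (fun t => 1 / Real.sqrt (-t)) t) := by
  refine locallyIntegrable_of_norm_le_rpow (C := 1) (α := 1 / 2) (by simp)
    (by rw [Module.finrank_self]; norm_num) ?_ ?_
  rotate_left
  · apply Measurable.aestronglyMeasurable
    exact (by fun_prop : Measurable (fun t : ℝ => 1 / Real.sqrt (-t))).indicator measurableSet_Iio
  · refine Filter.Eventually.of_forall fun t => ?_
    by_cases ht : t < 0
    · rw [Set.indicator_of_mem (by exact ht), Real.norm_eq_abs, Real.norm_eq_abs, abs_of_neg ht,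
        Real.rpow_neg (by linarith), ← Real.sqrt_eq_rpow, abs_of_nonneg (by positivity)]
      simp
    · rw [Set.indicator_of_notMem (by exact ht)]
      simp only [norm_zero]; positivity

lemma F0_smooth {M : ℝ} (hM : 0 < M) {φ0 φ1 : ℝ × ℝ → ℝ}
    (hφ0 : ContDiff ℝ (⊤ : ℕ∞) φ0) (hφ1 : ContDiff ℝ (⊤ : ℕ∞) φ1)
    (hs0 : SuppIn M φ0) (hs1 : SuppIn M φ1) (θ : ℝ) :
    ContDiff ℝ (⊤ : ℕ∞) (fun σ => F0 φ0 φ1 σ θ) ∧ ∀ σ, M ≤ σ → F0 φ0 φ1 σ θ = 0 := by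
  set h : ℝ → ℝ := fun s => radon φ1 s θ - deriv (fun s' => radon φ0 s' θ) s with hh
  have hz : ∀ s, M < |s| → h s = 0 := by
    intro s hs
    have : (fun s' => radon φ0 s' θ) =ᶠ[𝓝 s] fun _ => 0 := by
      filter_upwards [continuous_abs.continuousAt.eventually (lt_mem_nhds hs)] with x hx
      exact radon_zero hM hs0 x θ hx
    simp only [hh, this.deriv_eq, deriv_const, radon_zero hM hs1 s θ hs, sub_zero]
  have hsm : ContDiff ℝ (⊤ : ℕ∞) h := by
    apply (radon_smooth hM hs1 hφ1 θ).sub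
    exact ((contDiff_infty_iff_deriv).1 (radon_smooth hM hs0 hφ0 θ)).2
  have hcs : HasCompactSupport h := by
    apply HasCompactSupport.intro (isCompact_Icc (a := -M) (b := M))
    intro x hx
    apply hz
    by_contra hc
    exact hx (abs_le.1 (not_lt.1 hc))
  constructor
  · have := hcs.contDiff_convolution_left (ContinuousLinearMap.lsmul ℝ ℝ : ℝ →L[ℝ] ℝ →L[ℝ] ℝ)
      (n := (⊤ : ℕ∞)) hsm kernel_li
    have h2 := (contDiff_const (c := (1 / (2 * Real.pi * Real.sqrt 2)))).mul this
    refine (congrArg (ContDiff ℝ (⊤ : ℕ∞)) (funext fun σ => ?_)).mpr h2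
    unfold F0
    congr 1
    rw [← integral_indicator measurableSet_Ioi, convolution]
    congr 1
    ext s
    by_cases hs : σ < s
    · rw [Set.indicator_of_mem (by exact hs), Set.indicator_of_mem (by simpa using hs)]
      simp [hh, div_eq_mul_inv]
      ring
    · rw [Set.indicator_of_notMem (by exact hs), Set.indicator_of_notMem (by simpa using hs)]
      simp
  · intro σ hσ
    unfold F0
    rw [setIntegral_eq_zero_of_forall_eq_zero, mul_zero]
    intro s hs
    have hs' : σ < s := hs
    have := hz s (by rw [abs_of_pos (by linarith)]; linarith)
    simp only [hh] at this
    simp [this]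

/-- continuous form of `k` -/
lemma kfun_eq (d : Fin 3 → Fin 3 → ℝ) (e : Fin 3 → Fin 3 → Fin 3 → ℝ)
    (φ0 φ1 : ℝ × ℝ → ℝ) (ρ θ τ : ℝ) :
    kfun d e φ0 φ1 ρ θ τ = Real.exp (-τ * F1 d φ0 φ1 ρ θ) - F2 e φ0 φ1 ρ θ *
      ∫ u in (0 : ℝ)..τ, Real.exp (-u * F1 d φ0 φ1 ρ θ) := by
  unfold kfun
  split_ifs with h
  · simp [h]; ring
  · have : ∀ u ∈ Set.uIcc 0 τ, HasDerivAt (fun u => - Real.exp (-u * F1 d φ0 φ1 ρ θ) / F1 d φ0 φ1 ρ θ)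
        (Real.exp (-u * F1 d φ0 φ1 ρ θ)) u := by
      intro u _
      have := ((((hasDerivAt_id u).neg.mul_const (F1 d φ0 φ1 ρ θ)).exp).neg.div_const
        (F1 d φ0 φ1 ρ θ))
      refine this.congr_deriv ?_
      simp; field_simp
    rw [intervalIntegral.integral_eq_sub_of_hasDerivAt this
      (Continuous.intervalIntegrable (by fun_prop) _ _)]
    simp; field_simp; ring

lemma kfun_hasDeriv (d : Fin 3 → Fin 3 → ℝ) (e : Fin 3 → Fin 3 → Fin 3 → ℝ)
    (φ0 φ1 : ℝ × ℝ → ℝ) (ρ θ τ : ℝ) :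
    HasDerivAt (fun τ => kfun d e φ0 φ1 ρ θ τ)
      (-(F1 d φ0 φ1 ρ θ * kfun d e φ0 φ1 ρ θ τ + F2 e φ0 φ1 ρ θ)) τ := by
  unfold kfun
  split_ifs with h
  · have := ((hasDerivAt_id τ).mul_const (F2 e φ0 φ1 ρ θ)).const_sub 1
    refine this.congr_deriv ?_
    simp [h]
  · have := ((((hasDerivAt_id τ).neg.mul_const (F1 d φ0 φ1 ρ θ)).exp).mul_const
        (1 + F2 e φ0 φ1 ρ θ / F1 d φ0 φ1 ρ θ)).sub_const (F2 e φ0 φ1 ρ θ / F1 d φ0 φ1 ρ θ)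
    refine this.congr_deriv ?_
    simp; field_simp; ring

lemma param_deriv (F F' : ℝ → ℝ → ℝ) (a b τ : ℝ) (hF : ∀ x, Continuous (F x))
    (hF' : Continuous (Function.uncurry F'))
    (hd : ∀ x t, HasDerivAt (fun x => F x t) (F' x t) x) :
    HasDerivAt (fun x => ∫ t in a..b, F x t) (∫ t in a..b, F' τ t) τ := by
  obtain ⟨C, hC⟩ := ((isCompact_closedBall τ 1).prod (isCompact_uIcc (a := a) (b := b))).exists_bound_of_continuousOn
    hF'.continuousOn
  refine (intervalIntegral.hasDerivAt_integral_of_dominated_loc_of_deriv_le (bound := fun _ => C)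
    (Metric.closedBall_mem_nhds τ one_pos) (Eventually.of_forall fun x => (hF x).aestronglyMeasurable)
    ((hF τ).intervalIntegrable _ _) 
    (by exact (hF'.comp (by fun_prop : Continuous fun t => (τ, t))).aestronglyMeasurable)
    (Eventually.of_forall fun t ht x hx => hC (x, t) ⟨hx, Set.uIoc_subset_uIcc ht⟩)
    (by simp) (Eventually.of_forall fun t _ x _ => hd x t)).2

/-- The triple `(q, V̂, W)` solves the `ε = 0` blowup system (3.9). -/
theorem explicit_solution_of_blowup_system
    (M : ℝ) (hM : 0 < M)
    (φ0 φ1 : ℝ × ℝ → ℝ)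
    (hφ0 : ContDiff ℝ (⊤ : ℕ∞) φ0) (hφ1 : ContDiff ℝ (⊤ : ℕ∞) φ1)
    (hs0 : SuppIn M φ0) (hs1 : SuppIn M φ1)
    (d : Fin 3 → Fin 3 → ℝ)
    (hdsymm : ∀ i j, d i j = d j i) (hd00 : d 0 0 = 0)
    (hdne : ∃ i j : Fin 3, (i, j) ≠ ((0 : Fin 3), (0 : Fin 3)) ∧ d i j ≠ 0)
    (e : Fin 3 → Fin 3 → Fin 3 → ℝ)
    (hnull : NullCondFails e)
    :
    ∀ s θ τ : ℝ, s ≤ M → θ ∈ Set.Icc 0 (2 * Real.pi) → 0 ≤ τ →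
      (deriv (fun τ' => qflow M d e φ0 φ1 s θ τ') τ +
        ∑ i : Fin 3, ∑ j : Fin 3,
          (d i j * Vhat M d e φ0 φ1 s θ τ +
            ∑ k : Fin 3, e i j k * omegaHat θ k * Wfun φ0 φ1 s θ) *
          omegaHat θ i * omegaHat θ j = 0) ∧
      deriv (fun _ : ℝ => Wfun φ0 φ1 s θ) τ = 0 ∧
      deriv (fun s' => Vhat M d e φ0 φ1 s' θ τ) s
        = Wfun φ0 φ1 s θ * deriv (fun s' => qflow M d e φ0 φ1 s' θ τ) s ∧
      qflow M d e φ0 φ1 s θ 0 = s ∧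
      Vhat M d e φ0 φ1 s θ 0 = F0 φ0 φ1 s θ ∧
      qflow M d e φ0 φ1 M θ τ = M ∧
      Wfun φ0 φ1 M θ = 0 := by
  intro s θ τ _ _ _
  obtain ⟨hF, hFz⟩ := F0_smooth hM hφ0 hφ1 hs0 hs1 θ
  obtain ⟨hFd, hW⟩ := contDiff_infty_iff_deriv.1 hF
  obtain ⟨hWd, hW2⟩ := contDiff_infty_iff_deriv.1 hW
  have hWc : Continuous (fun ρ => Wfun φ0 φ1 ρ θ) := hW.continuous
  have hF1c : Continuous (fun ρ => F1 d φ0 φ1 ρ θ) := continuous_const.mul hW.continuous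
  have hF2c : Continuous (fun ρ => F2 e φ0 φ1 ρ θ) := continuous_const.mul hW2.continuous
  have hk2 : Continuous (fun p : ℝ × ℝ => kfun d e φ0 φ1 p.2 θ p.1) := by
    simp only [kfun_eq]
    have h1 : Continuous (fun p : ℝ × ℝ => F1 d φ0 φ1 p.2 θ) := hF1c.comp continuous_snd
    have h2 : Continuous (fun p : ℝ × ℝ => F2 e φ0 φ1 p.2 θ) := hF2c.comp continuous_snd
    have h3 : Continuous (fun p : ℝ × ℝ => ∫ u in (0 : ℝ)..p.1,
        Real.exp (-u * F1 d φ0 φ1 p.2 θ)) := by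
      apply intervalIntegral.continuous_parametric_intervalIntegral_of_continuous
        (f := fun (p : ℝ × ℝ) u => Real.exp (-u * F1 d φ0 φ1 p.2 θ)) _ continuous_fst
      have : Continuous (fun q : (ℝ × ℝ) × ℝ => F1 d φ0 φ1 q.1.2 θ) := h1.comp continuous_fst
      simp only [Function.uncurry_def]
      fun_prop
    fun_prop
  have hk : ∀ τ, Continuous (fun ρ => kfun d e φ0 φ1 ρ θ τ) := fun τ =>
    hk2.comp (by fun_prop : Continuous fun ρ => (τ, ρ))
  have hk0 : ∀ ρ, kfun d e φ0 φ1 ρ θ 0 = 1 := by intro ρ; simp [kfun_eq]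
  have hWM : Wfun φ0 φ1 M θ = 0 := by
    have h1 : HasDerivWithinAt (fun σ => F0 φ0 φ1 σ θ) (Wfun φ0 φ1 M θ) (Set.Ici M) M :=
      (hFd M).hasDerivAt.hasDerivWithinAt
    have h2 : HasDerivWithinAt (fun σ => F0 φ0 φ1 σ θ) 0 (Set.Ici M) M :=
      (hasDerivWithinAt_const M (Set.Ici M) (0 : ℝ)).congr (fun x hx => hFz x hx) (hFz M le_rfl)
    exact (uniqueDiffWithinAt_Ici M).eq_deriv _ h1 h2
  refine ⟨?_, by simp, ?_, ?_, ?_, by simp [qflow], hWM⟩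
  · have hder := (param_deriv (fun τ ρ => kfun d e φ0 φ1 ρ θ τ)
      (fun τ ρ => -(F1 d φ0 φ1 ρ θ * kfun d e φ0 φ1 ρ θ τ + F2 e φ0 φ1 ρ θ)) M s τ hk
      (by
        have h1 : Continuous (fun p : ℝ × ℝ => F1 d φ0 φ1 p.2 θ) := hF1c.comp continuous_snd
        have h2 : Continuous (fun p : ℝ × ℝ => F2 e φ0 φ1 p.2 θ) := hF2c.comp continuous_snd
        simp only [Function.uncurry_def]
        exact ((h1.mul hk2).add h2).neg)
      (fun x t => kfun_hasDeriv d e φ0 φ1 t θ x)).const_add M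
    have hder' : HasDerivAt (fun τ' => qflow M d e φ0 φ1 s θ τ') _ τ := hder
    rw [hder'.deriv, intervalIntegral.integral_neg, intervalIntegral.integral_add
      (Continuous.intervalIntegrable (hF1c.fun_mul (hk τ)) _ _) (hF2c.intervalIntegrable _ _)]
    have e1 : ∫ ρ in M..s, F1 d φ0 φ1 ρ θ * kfun d e φ0 φ1 ρ θ τ =
        (∑ i : Fin 3, ∑ j : Fin 3, d i j * omegaHat θ i * omegaHat θ j) *
          Vhat M d e φ0 φ1 s θ τ := by
      rw [Vhat, ← intervalIntegral.integral_const_mul]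
      congr 1; ext ρ
      rw [F1, Wfun, mul_assoc]
    have e2 : ∫ ρ in M..s, F2 e φ0 φ1 ρ θ =
        (∑ i : Fin 3, ∑ j : Fin 3, ∑ k : Fin 3,
          e i j k * omegaHat θ i * omegaHat θ j * omegaHat θ k) * Wfun φ0 φ1 s θ := by
      simp only [F2]
      rw [intervalIntegral.integral_const_mul, intervalIntegral.integral_eq_sub_of_hasDerivAt
        (fun x _ => (hWd x).hasDerivAt) (hW2.continuous.intervalIntegrable _ _)]
      have : deriv (fun σ => F0 φ0 φ1 σ θ) M = 0 := hWM
      rw [this, sub_zero, Wfun]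
    rw [e1, e2]
    simp only [Fin.sum_univ_three]
    ring
  · have h1 : HasDerivAt (fun s' => Vhat M d e φ0 φ1 s' θ τ) _ s :=
      (hWc.mul (hk τ)).integral_hasStrictDerivAt M s |>.hasDerivAt
    have h2 : HasDerivAt (fun s' => qflow M d e φ0 φ1 s' θ τ) _ s :=
      ((hk τ).integral_hasStrictDerivAt M s).hasDerivAt.const_add M
    rw [h1.deriv, h2.deriv]
    rfl
  · simp [qflow, hk0]
  · simp only [Vhat, hk0, mul_one, Wfun]
    rw [intervalIntegral.integral_eq_sub_of_hasDerivAt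
        (fun x _ => (hFd x).hasDerivAt) (hW.continuous.intervalIntegrable _ _), hFz M le_rfl, sub_zero]
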